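/- arXiv:1610.06846 — 7 statements merged into one kernel-verified Lean document; each statement's English description precedes it below -/
import Mathlib

section
/- Let (Ω, 𝔓) be a probability space and let W : Ω → ℝ be a nonnegative random variable such that log(1 + W) is integrable. Then E[log(1 + W)] = ∫₀^∞ (1 − E[e^{−zW}]) · e^{−z}/z dz, where the integral on the right is over z ∈ (0, ∞) with respect to Lebesgue measure. -/
open MeasureTheory Real Set

lemma one_sub_exp_mul_exp_div_nonneg {w z : ℝ} (hw : 0 ≤ w) (hz : 0 < z) :
    0 ≤ (1 - exp (-(z * w))) * exp (-z) / z := by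
  have h : exp (-(z * w)) ≤ 1 := exp_le_one_iff.2 (by nlinarith)
  have h' : 0 ≤ 1 - exp (-(z * w)) := by linarith
  positivity

lemma integrableOn_one_sub_exp_mul_exp_div {w : ℝ} (hw : 0 ≤ w) :
    IntegrableOn (fun z ↦ (1 - exp (-(z * w))) * exp (-z) / z) (Ioi 0) := by
  have hdom : IntegrableOn (fun z ↦ w * exp (-z)) (Ioi 0) := by
    simpa [IntegrableOn] using (integrableOn_exp_mul_Ioi (a := -1) (by norm_num) 0).const_mul w
  refine hdom.mono' (Measurable.aestronglyMeasurable (by fun_prop)) ?_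
  filter_upwards [ae_restrict_mem measurableSet_Ioi] with z (hz : 0 < z)
  rw [norm_of_nonneg (one_sub_exp_mul_exp_div_nonneg hw hz), div_le_iff₀ hz]
  have h : 1 - exp (-(z * w)) ≤ z * w := by linarith [add_one_le_exp (-(z * w))]
  calc (1 - exp (-(z * w))) * exp (-z) ≤ z * w * exp (-z) := by gcongr
    _ = w * exp (-z) * z := by ring

/-- The logarithm `log (1 + w)` as a Frullani integral. -/
lemma integral_one_sub_exp_mul_exp_div {w : ℝ} (hw : 0 ≤ w) :
    ∫ z in Ioi (0 : ℝ), (1 - exp (-(z * w))) * exp (-z) / z = log (1 + w) := by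
  have heq (z : ℝ) : (1 - exp (-(z * w))) * exp (-z) / z
      = z⁻¹ • (exp (-(1 * z)) - exp (-((1 + w) * z))) := by
    rw [show -((1 + w) * z) = -(z * w) + -z by ring, exp_add, smul_eq_mul, one_mul]
    ring
  have hint := integrableOn_one_sub_exp_mul_exp_div hw
  simp_rw [heq] at hint ⊢
  have hcont : Continuous fun x : ℝ ↦ exp (-x) := by fun_prop
  rw [Frullani.integral_Ioi_eq (f := fun x ↦ exp (-x)) (L := 1) (R := 0)
    (hcont.locallyIntegrable.locallyIntegrableOn _) one_pos (by linarith) ?_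
    tendsto_exp_neg_atTop_nhds_zero hint]
  · simp
  · simpa using (hcont.tendsto 0).mono_left nhdsWithin_le_nhds

theorem hamdi_single_variable
    {Ω : Type*} [MeasurableSpace Ω] (𝔓 : Measure Ω) [IsProbabilityMeasure 𝔓]
    (W : Ω → ℝ) (hW : ∀ ω, 0 ≤ W ω)
    (hint : Integrable (fun ω => Real.log (1 + W ω)) 𝔓) :
    ∫ ω, Real.log (1 + W ω) ∂𝔓
      = ∫ z in Set.Ioi (0:ℝ),
          (1 - ∫ ω, Real.exp (-(z * W ω)) ∂𝔓) * Real.exp (-z) / z := by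
  have hWm : AEMeasurable W 𝔓 := by
    refine ((measurable_exp.comp_aemeasurable hint.aemeasurable).sub_const 1).congr (.of_forall ?_)
    intro ω
    simp [exp_log (show 0 < 1 + W ω by linarith [hW ω])]
  have hprod : Integrable
      (Function.uncurry fun ω z ↦ (1 - exp (-(z * W ω))) * exp (-z) / z)
      (𝔓.prod (volume.restrict (Ioi 0))) := by
    have hWfst : AEMeasurable (fun p : Ω × ℝ ↦ W p.1) (𝔓.prod (volume.restrict (Ioi 0))) :=
      hWm.comp_fst
    refine (integrable_prod_iff ?_).2 ⟨?_, ?_⟩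
    · refine AEMeasurable.aestronglyMeasurable ?_
      unfold Function.uncurry
      fun_prop
    · exact .of_forall fun ω ↦ integrableOn_one_sub_exp_mul_exp_div (hW ω)
    · refine hint.congr (.of_forall fun ω ↦ ?_)
      simp only [Function.uncurry_apply_pair]
      rw [← integral_one_sub_exp_mul_exp_div (hW ω)]
      exact setIntegral_congr_fun measurableSet_Ioi fun z hz ↦
        (norm_of_nonneg (one_sub_exp_mul_exp_div_nonneg (hW ω) hz)).symm
  simp_rw [← integral_one_sub_exp_mul_exp_div (hW _)]
  rw [integral_integral_swap hprod]
  refine setIntegral_congr_fun measurableSet_Ioi fun z (hz : 0 < z) ↦ ?_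
  have hexp : Integrable (fun ω ↦ exp (-(z * W ω))) 𝔓 := by
    refine Integrable.of_bound (AEMeasurable.aestronglyMeasurable (by fun_prop)) 1
      (.of_forall fun ω ↦ ?_)
    rw [norm_of_nonneg (exp_pos _).le, exp_le_one_iff, neg_nonpos]
    exact mul_nonneg hz.le (hW ω)
  simp only [integral_div, integral_mul_const]
  rw [integral_sub (integrable_const 1) hexp]
  simp
end

section
/- Let (Ω, 𝔓) be a probability space and let X, Y : Ω → ℝ be independent nonnegative random variables such that log(1 + X + Y) is integrable. Then E[log(1 + X/(1 + Y))] = ∫₀^∞ E[e^{−zY}] · (1 − E[e^{−zX}]) · e^{−z}/z dz, where the integral on the right is over z ∈ (0, ∞) with respect to Lebesgue measure. -/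
open MeasureTheory Real Set

/-- A set whose outer measure and that of its complement add up to the total mass of a finite
measure is null measurable. -/
theorem nullMeasurableSet_of_measure_add_compl_le {Ω : Type*} [MeasurableSpace Ω] {μ : Measure Ω}
    [IsFiniteMeasure μ] {s : Set Ω} (h : μ s + μ sᶜ ≤ μ univ) : NullMeasurableSet s μ := by
  have hcover : toMeasurable μ s ∪ toMeasurable μ sᶜ = univ := by
    rw [eq_univ_iff_forall]
    intro x
    by_cases hx : x ∈ s
    · exact Or.inl (subset_toMeasurable μ s hx)
    · exact Or.inr (subset_toMeasurable μ sᶜ hx)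
  have hadd := measure_union_add_inter (μ := μ) (toMeasurable μ s)
    (measurableSet_toMeasurable μ sᶜ)
  rw [hcover, measure_toMeasurable, measure_toMeasurable] at hadd
  have hzero : μ (toMeasurable μ s ∩ toMeasurable μ sᶜ) = 0 := by
    have hle : μ univ + μ (toMeasurable μ s ∩ toMeasurable μ sᶜ) ≤ μ univ + 0 := by
      rw [hadd, add_zero]; exact h
    exact nonpos_iff_eq_zero.1 ((ENNReal.add_le_add_iff_left (measure_ne_top μ _)).1 hle)
  refine (measurableSet_toMeasurable μ s).nullMeasurableSet.congr ?_
  refine (ae_le_set.2 (measure_mono_null ?_ hzero)).antisymm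
    (subset_toMeasurable μ s).eventuallyLE
  exact fun x hx => ⟨hx.1, subset_toMeasurable μ sᶜ hx.2⟩

/-- Some half-open interval of given length is charged by the image of a nonzero measure, even if
the map is not measurable. -/
theorem exists_measure_preimage_floor_ne_zero {Ω : Type*} [MeasurableSpace Ω] {μ : Measure Ω}
    [NeZero μ] (X : Ω → ℝ) (δ : ℝ) : ∃ n : ℤ, μ (X ⁻¹' {x | ⌊x / δ⌋ = n}) ≠ 0 := by
  by_contra! h
  have hnull := measure_iUnion_null h
  have huniv : ⋃ n : ℤ, X ⁻¹' {x | ⌊x / δ⌋ = n} = univ := by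
    ext ω
    simp
  rw [huniv, Measure.measure_univ_eq_zero] at hnull
  exact NeZero.ne μ hnull

/-- If `X` and `Y` are independent and `X + Y` is measurable, then the (outer) law of `Y` is
additive on measurable sets at positive distance, even if `X` and `Y` are not measurable. -/
theorem measure_preimage_union_of_indepFun_of_add {Ω : Type*} [MeasurableSpace Ω] {μ : Measure Ω}
    [IsProbabilityMeasure μ] {X Y : Ω → ℝ} (hindep : ProbabilityTheory.IndepFun X Y μ)
    (hadd : AEMeasurable (fun ω => X ω + Y ω) μ) {s t : Set ℝ} (hs : MeasurableSet s)
    (ht : MeasurableSet t) {δ : ℝ} (hδ : 0 < δ) (hst : ∀ x ∈ s, ∀ y ∈ t, 2 * δ ≤ dist x y) :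
    μ (Y ⁻¹' (s ∪ t)) = μ (Y ⁻¹' s) + μ (Y ⁻¹' t) := by
  obtain ⟨n, hn⟩ := exists_measure_preimage_floor_ne_zero (μ := μ) X δ
  set A : Set ℝ := {x | ⌊x / δ⌋ = n} with hA
  have hAm : MeasurableSet A := measurableSet_eq_fun (by fun_prop) measurable_const
  have hA_near : ∀ x ∈ A, |x - n * δ| < δ := by
    intro x hx
    obtain ⟨h1, h2⟩ := Int.floor_eq_iff.1 (show ⌊x / δ⌋ = n from hx)
    rw [le_div_iff₀ hδ] at h1
    rw [div_lt_iff₀ hδ] at h2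
    rw [abs_lt]
    constructor <;> linarith
  have hT : NullMeasurableSet ((fun ω => X ω + Y ω) ⁻¹'
      ((fun x => x - n * δ) ⁻¹' Metric.thickening δ s)) μ :=
    hadd.nullMeasurable
      ((Metric.isOpen_thickening.preimage (by fun_prop)).measurableSet)
  have hsplit := measure_inter_add_sdiff₀ (μ := μ) (X ⁻¹' A ∩ Y ⁻¹' (s ∪ t)) hT
  have hfar : ∀ ω, X ω ∈ A → Y ω ∈ t → X ω + Y ω - n * δ ∉ Metric.thickening δ s := by
    intro ω hx hy hmem
    obtain ⟨z, hz, hdist⟩ := Metric.mem_thickening_iff.1 hmem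
    have h1 := hst z hz _ hy
    have h2 := hA_near _ hx
    rw [Real.dist_eq] at h1 hdist
    rw [abs_lt] at h2 hdist
    rcases le_abs.1 h1 with h | h <;> linarith
  have hnear : ∀ ω, X ω ∈ A → Y ω ∈ s → X ω + Y ω - n * δ ∈ Metric.thickening δ s := by
    intro ω hx hy
    refine Metric.mem_thickening_iff.2 ⟨Y ω, hy, ?_⟩
    rw [Real.dist_eq]
    convert hA_near _ hx using 2
    ring
  have hinter : X ⁻¹' A ∩ Y ⁻¹' (s ∪ t) ∩ ((fun ω => X ω + Y ω) ⁻¹'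
      ((fun x => x - n * δ) ⁻¹' Metric.thickening δ s)) = X ⁻¹' A ∩ Y ⁻¹' s := by
    ext ω
    have := hfar ω
    have := hnear ω
    simp only [mem_inter_iff, mem_preimage, mem_union]
    tauto
  have hdiff : (X ⁻¹' A ∩ Y ⁻¹' (s ∪ t)) \ ((fun ω => X ω + Y ω) ⁻¹'
      ((fun x => x - n * δ) ⁻¹' Metric.thickening δ s)) = X ⁻¹' A ∩ Y ⁻¹' t := by
    ext ω
    have := hfar ω
    have := hnear ω
    simp only [mem_inter_iff, mem_sdiff, mem_preimage, mem_union]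
    tauto
  rw [hinter, hdiff, hindep.measure_inter_preimage_eq_mul _ _ hAm hs,
    hindep.measure_inter_preimage_eq_mul _ _ hAm ht,
    hindep.measure_inter_preimage_eq_mul _ _ hAm (hs.union ht), ← mul_add] at hsplit
  exact ((ENNReal.mul_right_inj hn (measure_ne_top μ _)).1 hsplit).symm

/-- If `X` and `Y` are independent, in the sense that their preimage σ-algebras are, and `X + Y` is
a.e. measurable, then so is `Y`. -/
theorem aemeasurable_right_of_indepFun_of_add {Ω : Type*} [MeasurableSpace Ω] {μ : Measure Ω}
    [IsProbabilityMeasure μ] {X Y : Ω → ℝ} (hindep : ProbabilityTheory.IndepFun X Y μ)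
    (hadd : AEMeasurable (fun ω => X ω + Y ω) μ) : AEMeasurable Y μ := by
  set m : OuterMeasure ℝ := OuterMeasure.map Y μ.toOuterMeasure with hm
  have hm_apply : ∀ s, m s = μ (Y ⁻¹' s) := fun s => rfl
  have hmetric : m.trim.IsMetric := by
    rintro s t ⟨r, hr, hst⟩
    obtain ⟨c, hc, hcr⟩ := ENNReal.lt_iff_exists_nnreal_btwn.1 (pos_iff_ne_zero.2 hr)
    have hc' : (0 : ℝ) < c := by exact_mod_cast hc
    have hdist : ∀ x ∈ closure s, ∀ y ∈ closure t, 2 * ((c : ℝ) / 2) ≤ dist x y := by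
      intro x hx y hy
      rw [mul_div_cancel₀ _ two_ne_zero]
      refine map_mem_closure₂ (f := fun a b : ℝ => dist a b) (u := Ici (c : ℝ)) continuous_dist
        hx hy (fun a ha b hb => ?_) |> isClosed_Ici.closure_subset_iff.2 subset_rfl
      have := hcr.le.trans (hst a ha b hb)
      rw [edist_nndist] at this
      exact_mod_cast this
    refine (measure_union_le s t).antisymm ?_
    rw [OuterMeasure.trim_eq_iInf m (s ∪ t)]
    refine le_iInf fun B => le_iInf fun hB => le_iInf fun hBm => ?_
    have hsB : MeasurableSet (B ∩ closure s) := hBm.inter measurableSet_closure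
    have htB : MeasurableSet (B ∩ closure t) := hBm.inter measurableSet_closure
    calc m.trim s + m.trim t
        ≤ m.trim (B ∩ closure s) + m.trim (B ∩ closure t) :=
          add_le_add
            (measure_mono fun x hx => ⟨hB (Or.inl hx), subset_closure hx⟩)
            (measure_mono fun x hx => ⟨hB (Or.inr hx), subset_closure hx⟩)
      _ = m (B ∩ closure s ∪ B ∩ closure t) := by
          rw [OuterMeasure.trim_eq m hsB, OuterMeasure.trim_eq m htB, hm_apply, hm_apply, hm_apply,
            measure_preimage_union_of_indepFun_of_add hindep hadd hsB htB (half_pos hc')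
              fun x hx y hy => hdist x hx.2 y hy.2]
      _ ≤ m B := measure_mono (union_subset inter_subset_left inter_subset_left)
  refine NullMeasurable.aemeasurable fun s hs => nullMeasurableSet_of_measure_add_compl_le ?_
  have hcar := (OuterMeasure.isCaratheodory_iff m.trim).1 (hmetric.le_caratheodory s hs) univ
  rw [univ_inter, ← compl_eq_univ_sdiff, OuterMeasure.trim_eq m hs,
    OuterMeasure.trim_eq m hs.compl, OuterMeasure.trim_eq m MeasurableSet.univ] at hcar
  exact hcar.ge

/-- The integrand of Frullani's integral for the exponential function is integrable. -/
theorem integrableOn_exp_sub_exp_div {a b : ℝ} (ha : 0 < a) (hab : a ≤ b) :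
    IntegrableOn (fun z => (exp (-(z * a)) - exp (-(z * b))) / z) (Ioi 0) := by
  have hdom : IntegrableOn (fun z => (b - a) * exp (-a * z)) (Ioi 0) :=
    (integrableOn_exp_mul_Ioi (neg_neg_of_pos ha) 0).const_mul _
  refine hdom.mono' (Measurable.aestronglyMeasurable (by fun_prop)) ?_
  filter_upwards [ae_restrict_mem measurableSet_Ioi] with z hz
  have hz : 0 < z := hz
  have hle : exp (-(z * b)) ≤ exp (-(z * a)) := by gcongr
  rw [norm_of_nonneg (div_nonneg (sub_nonneg.2 hle) hz.le), div_le_iff₀ hz]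
  have hfactor : exp (-(z * b)) = exp (-(z * a)) * exp (-(z * (b - a))) := by
    rw [← exp_add]; ring_nf
  have hlin := add_one_le_exp (-(z * (b - a)))
  rw [hfactor, show -a * z = -(z * a) by ring]
  nlinarith [exp_pos (-(z * a))]

/-- **Frullani's integral** for the exponential function. -/
theorem integral_exp_sub_exp_div {a b : ℝ} (ha : 0 < a) (hab : a ≤ b) :
    ∫ z in Ioi (0 : ℝ), (exp (-(z * a)) - exp (-(z * b))) / z = log (b / a) := by
  have hcongr : ∀ z : ℝ, (exp (-(z * a)) - exp (-(z * b))) / z =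
      z⁻¹ • (exp (-(a * z)) - exp (-(b * z))) := by
    intro z
    rw [smul_eq_mul, div_eq_inv_mul, mul_comm a, mul_comm b]
  have hint := integrableOn_exp_sub_exp_div ha hab
  simp_rw [hcongr] at hint ⊢
  have hcont : Continuous fun x : ℝ => exp (-x) := by fun_prop
  have hzero : Filter.Tendsto (fun x : ℝ => exp (-x)) (nhdsWithin 0 (Ioi 0)) (nhds 1) := by
    simpa using (hcont.tendsto 0).mono_left nhdsWithin_le_nhds
  rw [Frullani.integral_Ioi_eq (f := fun x : ℝ => exp (-x))
    (hcont.locallyIntegrable.locallyIntegrableOn _) ha (ha.trans_le hab) hzero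
    tendsto_exp_neg_atTop_nhds_zero hint]
  simp

theorem hamdi_mgf_lemma
    {Ω : Type*} [MeasurableSpace Ω] (𝔓 : Measure Ω) [IsProbabilityMeasure 𝔓]
    (X Y : Ω → ℝ) (hX : ∀ ω, 0 ≤ X ω) (hY : ∀ ω, 0 ≤ Y ω)
    (hindep : ProbabilityTheory.IndepFun X Y 𝔓)
    (hint : Integrable (fun ω => Real.log (1 + X ω + Y ω)) 𝔓) :
    ∫ ω, Real.log (1 + X ω / (1 + Y ω)) ∂𝔓
      = ∫ z in Set.Ioi (0:ℝ),
          (∫ ω, Real.exp (-(z * Y ω)) ∂𝔓) * (1 - ∫ ω, Real.exp (-(z * X ω)) ∂𝔓)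
            * Real.exp (-z) / z := by
  have hadd : AEMeasurable (fun ω => X ω + Y ω) 𝔓 := by
    refine (hint.aemeasurable.exp.sub_const 1).congr (.of_forall fun ω => ?_)
    have := hX ω
    have := hY ω
    simp only [exp_log (show 0 < 1 + X ω + Y ω by linarith)]
    ring
  have hYm : AEMeasurable Y 𝔓 := aemeasurable_right_of_indepFun_of_add hindep hadd
  have hXm : AEMeasurable X 𝔓 :=
    aemeasurable_right_of_indepFun_of_add hindep.symm (by simpa only [add_comm] using hadd)
  set F : Ω → ℝ → ℝ := fun ω z =>
    (exp (-(z * (1 + Y ω))) - exp (-(z * (1 + X ω + Y ω)))) / z with hF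
  have hpos : ∀ ω, 0 < 1 + Y ω := fun ω => by linarith [hY ω]
  have hle : ∀ ω, 1 + Y ω ≤ 1 + X ω + Y ω := fun ω => by linarith [hX ω]
  have hlog : ∀ ω, ∫ z in Ioi (0 : ℝ), F ω z = log (1 + X ω / (1 + Y ω)) := by
    intro ω
    rw [hF, integral_exp_sub_exp_div (hpos ω) (hle ω)]
    congr 1
    field_simp [(hpos ω).ne']
    ring
  have hFnonneg : ∀ ω, ∀ z ∈ Ioi (0 : ℝ), 0 ≤ F ω z := by
    intro ω z hz
    have hz : 0 < z := hz
    refine div_nonneg (sub_nonneg.2 (exp_le_exp.2 ?_)) hz.le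
    nlinarith [hle ω]
  have hFint : Integrable (Function.uncurry F) (𝔓.prod (volume.restrict (Ioi 0))) := by
    have hX' : AEMeasurable (fun p : Ω × ℝ => X p.1) (𝔓.prod (volume.restrict (Ioi 0))) :=
      hXm.comp_fst
    have hY' : AEMeasurable (fun p : Ω × ℝ => Y p.1) (𝔓.prod (volume.restrict (Ioi 0))) :=
      hYm.comp_fst
    have hmeas : AEMeasurable (Function.uncurry F) (𝔓.prod (volume.restrict (Ioi 0))) := by
      simp only [hF, Function.uncurry_def]
      fun_prop
    refine (integrable_prod_iff hmeas.aestronglyMeasurable).2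
      ⟨.of_forall fun ω => integrableOn_exp_sub_exp_div (hpos ω) (hle ω), ?_⟩
    have hnorm : ∀ ω, ∫ z in Ioi (0 : ℝ), ‖Function.uncurry F (ω, z)‖ =
        log (1 + X ω / (1 + Y ω)) := by
      intro ω
      rw [← hlog ω]
      exact setIntegral_congr_fun measurableSet_Ioi fun z hz => norm_of_nonneg (hFnonneg ω z hz)
    simp_rw [hnorm]
    refine hint.mono' (AEMeasurable.aestronglyMeasurable (by fun_prop)) (.of_forall fun ω => ?_)
    have hquot : 0 ≤ X ω / (1 + Y ω) := div_nonneg (hX ω) (hpos ω).le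
    rw [norm_of_nonneg (log_nonneg (by linarith))]
    have := div_le_self (hX ω) (show 1 ≤ 1 + Y ω by linarith [hY ω])
    exact log_le_log (by linarith) (by linarith [hY ω])
  have hexp : ∀ z ∈ Ioi (0 : ℝ), ∀ Z : Ω → ℝ, (∀ ω, 0 ≤ Z ω) → AEMeasurable Z 𝔓 →
      Integrable (fun ω => exp (-(z * Z ω))) 𝔓 := by
    intro z hz Z hZ hZm
    refine Integrable.of_bound (by fun_prop) 1 (.of_forall fun ω => ?_)
    rw [norm_of_nonneg (exp_pos _).le, exp_le_one_iff]
    exact neg_nonpos.2 (mul_nonneg (le_of_lt hz) (hZ ω))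
  simp_rw [← hlog]
  rw [integral_integral_swap hFint]
  refine setIntegral_congr_fun measurableSet_Ioi fun z hz => ?_
  have hprod : ∫ ω, exp (-(z * (X ω + Y ω))) ∂𝔓 =
      (∫ ω, exp (-(z * X ω)) ∂𝔓) * ∫ ω, exp (-(z * Y ω)) ∂𝔓 := by
    rw [← hindep.integral_fun_comp_mul_comp (f := fun x => exp (-(z * x)))
      (g := fun y => exp (-(z * y))) hXm hYm (by fun_prop) (by fun_prop)]
    simp_rw [← exp_add]
    ring_nf
  have hFz : ∀ ω, F ω z =
      (exp (-(z * Y ω)) - exp (-(z * (X ω + Y ω)))) * (exp (-z) / z) := by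
    intro ω
    simp only [hF]
    rw [show -(z * (1 + Y ω)) = -(z * Y ω) + -z by ring,
      show -(z * (1 + X ω + Y ω)) = -(z * (X ω + Y ω)) + -z by ring, exp_add, exp_add]
    ring
  simp_rw [hFz]
  rw [integral_mul_const, integral_sub (hexp z hz Y hY hYm)
    (hexp z hz _ (fun ω => add_nonneg (hX ω) (hY ω)) hadd), hprod]
  ring
end

section
/- For every real α > 2 and every real c > 0, the improper integral ∫₀^∞ 2rc/(r^α + c) dr converges and equals Γ(1 − 2/α) · Γ(1 + 2/α) · c^{2/α}, where Γ denotes the real Gamma function. -/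
open MeasureTheory Real Set

theorem lintegral_rpow_mul_exp_neg_mul_Ioi {a b : ℝ} (ha : 0 < a) (hb : 0 < b) :
    ∫⁻ x in Ioi (0:ℝ), ENNReal.ofReal (x ^ (a - 1) * exp (-(b * x)))
      = ENNReal.ofReal ((1 / b) ^ a * Gamma a) := by
  have key := integral_rpow_mul_exp_neg_mul_Ioi ha hb
  have hpos : 0 < (1 / b) ^ a * Gamma a := mul_pos (by positivity) (Gamma_pos_of_pos ha)
  have hint : IntegrableOn (fun x : ℝ => x ^ (a - 1) * exp (-(b * x))) (Ioi 0) :=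
    Integrable.of_integral_ne_zero (by rw [key]; exact hpos.ne')
  rw [← key, ofReal_integral_eq_lintegral_ofReal hint]
  filter_upwards [ae_restrict_mem measurableSet_Ioi] with x hx
  have : (0:ℝ) < x := hx
  positivity

theorem lintegral_rpow_div_add_Ioi {s c : ℝ} (hs : 0 < s) (hs1 : s < 1) (hc : 0 < c) :
    ∫⁻ x in Ioi (0:ℝ), ENNReal.ofReal (x ^ (s - 1) / (x + c))
      = ENNReal.ofReal (Gamma s * Gamma (1 - s) * c ^ (s - 1)) := by
  have inner_t : ∀ x ∈ Ioi (0:ℝ), ENNReal.ofReal (x ^ (s - 1) / (x + c))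
      = ∫⁻ t in Ioi (0:ℝ), ENNReal.ofReal (x ^ (s - 1) * exp (-((x + c) * t))) := by
    intro x hx
    have hx : (0:ℝ) < x := hx
    have h := lintegral_rpow_mul_exp_neg_mul_Ioi one_pos (add_pos hx hc)
    simp only [sub_self, rpow_zero, one_mul, rpow_one, Gamma_one, mul_one] at h
    simp_rw [ENNReal.ofReal_mul (rpow_nonneg hx.le (s - 1))]
    rw [lintegral_const_mul _ (by fun_prop), h, ← ENNReal.ofReal_mul (by positivity),
      mul_one_div]
  have inner_x : ∀ t ∈ Ioi (0:ℝ),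
      ∫⁻ x in Ioi (0:ℝ), ENNReal.ofReal (x ^ (s - 1) * exp (-((x + c) * t)))
      = ENNReal.ofReal (Gamma s) * ENNReal.ofReal (t ^ (1 - s - 1) * exp (-(c * t))) := by
    intro t ht
    have ht : (0:ℝ) < t := ht
    have hsplit : ∀ x : ℝ, ENNReal.ofReal (x ^ (s - 1) * exp (-((x + c) * t)))
        = ENNReal.ofReal (exp (-(c * t))) * ENNReal.ofReal (x ^ (s - 1) * exp (-(t * x))) := by
      intro x
      rw [← ENNReal.ofReal_mul (exp_pos _).le, mul_left_comm, ← exp_add]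
      ring_nf
    simp_rw [hsplit]
    rw [lintegral_const_mul _ (by fun_prop), lintegral_rpow_mul_exp_neg_mul_Ioi hs ht,
      ← ENNReal.ofReal_mul (exp_pos _).le, ← ENNReal.ofReal_mul (Gamma_pos_of_pos hs).le,
      one_div, inv_rpow ht.le, ← rpow_neg ht.le, show 1 - s - 1 = -s by ring]
    ring_nf
  rw [setLIntegral_congr_fun measurableSet_Ioi inner_t,
    lintegral_lintegral_swap (by fun_prop),
    setLIntegral_congr_fun measurableSet_Ioi inner_x, lintegral_const_mul _ (by fun_prop),
    lintegral_rpow_mul_exp_neg_mul_Ioi (sub_pos.2 hs1) hc,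
    ← ENNReal.ofReal_mul (Gamma_pos_of_pos hs).le, one_div, inv_rpow hc.le, ← rpow_neg hc.le,
    neg_sub]
  ring_nf

theorem integral_rpow_div_add_Ioi {s c : ℝ} (hs : 0 < s) (hs1 : s < 1) (hc : 0 < c) :
    ∫ x in Ioi (0:ℝ), x ^ (s - 1) / (x + c) = Gamma s * Gamma (1 - s) * c ^ (s - 1) := by
  have hG := Gamma_pos_of_pos hs
  have hG' := Gamma_pos_of_pos (sub_pos.2 hs1)
  rw [integral_eq_lintegral_of_nonneg_ae, lintegral_rpow_div_add_Ioi hs hs1 hc,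
    ENNReal.toReal_ofReal (by positivity)]
  · filter_upwards [ae_restrict_mem measurableSet_Ioi] with x hx
    have : (0:ℝ) < x := hx
    positivity
  · exact Measurable.aestronglyMeasurable (by fun_prop)

theorem interference_exponent_rayleigh
    (α c : ℝ) (hα : 2 < α) (hc : 0 < c) :
    IntegrableOn (fun r : ℝ => 2 * r * c / (r ^ α + c)) (Set.Ioi (0:ℝ)) ∧
    ∫ r in Set.Ioi (0:ℝ), 2 * r * c / (r ^ α + c)
      = Real.Gamma (1 - 2 / α) * Real.Gamma (1 + 2 / α) * c ^ (2 / α) := by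
  have hα0 : 0 < α := by linarith
  have hs : 0 < 2 / α := by positivity
  have hs1 : 2 / α < 1 := (div_lt_one hα0).2 hα
  have hsubst : ∀ r ∈ Ioi (0:ℝ), 2 * r * c / (r ^ α + c) = (2 / α * c) *
      ((α * r ^ (α - 1)) • ((r ^ α) ^ (2 / α - 1) / (r ^ α + c))) := by
    intro r hr
    have hr : (0:ℝ) < r := hr
    have hpow : r ^ (α - 1) * (r ^ α) ^ (2 / α - 1) = r := by
      rw [← rpow_mul hr.le, ← rpow_add hr,
        show α - 1 + α * (2 / α - 1) = 1 by field_simp; ring, rpow_one]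
    rw [smul_eq_mul, mul_assoc α, ← mul_div_assoc, hpow]
    field_simp
  have heq : ∫ r in Ioi (0:ℝ), 2 * r * c / (r ^ α + c)
      = Gamma (1 - 2 / α) * Gamma (1 + 2 / α) * c ^ (2 / α) := by
    rw [setIntegral_congr_fun measurableSet_Ioi hsubst, integral_const_mul,
      integral_comp_rpow_Ioi_of_pos (g := fun y => y ^ (2 / α - 1) / (y + c)) hα0,
      integral_rpow_div_add_Ioi hs hs1 hc, add_comm 1, Gamma_add_one hs.ne', rpow_sub_one hc.ne']
    field_simp
  have hpos : 0 < Gamma (1 - 2 / α) * Gamma (1 + 2 / α) * c ^ (2 / α) :=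
    mul_pos (mul_pos (Gamma_pos_of_pos (sub_pos.2 hs1)) (Gamma_pos_of_pos (by positivity)))
      (by positivity)
  exact ⟨Integrable.of_integral_ne_zero (by rw [heq]; exact hpos.ne'), heq⟩
end

section
/- Let (Ω, 𝔓) be a probability space and let H : Ω → ℝ be a nonnegative random variable with E[H^{2/α}] < ∞, where α > 2 is real. Then for every real c > 0, the improper integral ∫₀^∞ 2r · (1 − E[e^{−c·H·r^{−α}}]) dr converges and equals Γ(1 − 2/α) · c^{2/α} · E[H^{2/α}], where Γ denotes the real Gamma function. -/
open MeasureTheory Real Set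

open Filter Topology

lemma one_sub_exp_neg_nonneg {x : ℝ} (hx : 0 ≤ x) : 0 ≤ 1 - exp (-x) :=
  sub_nonneg.2 (exp_le_one_iff.2 (neg_nonpos.2 hx))

lemma one_sub_exp_neg_le_self (x : ℝ) : 1 - exp (-x) ≤ x := by
  linarith [add_one_le_exp (-x)]

lemma one_sub_exp_neg_le_one (x : ℝ) : 1 - exp (-x) ≤ 1 := by
  linarith [exp_pos (-x)]

lemma integrableOn_two_mul_one_sub_exp_neg_mul_rpow {α : ℝ} (hα : 2 < α) {a : ℝ} (ha : 0 ≤ a) :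
    IntegrableOn (fun r : ℝ => 2 * r * (1 - exp (-(a * r ^ (-α))))) (Ioi 0) := by
  have hmeas : Measurable fun r : ℝ => 2 * r * (1 - exp (-(a * r ^ (-α)))) := by fun_prop
  have hnonneg : ∀ r : ℝ, 0 < r → 0 ≤ 1 - exp (-(a * r ^ (-α))) := fun r hr =>
    one_sub_exp_neg_nonneg (by positivity)
  rw [← Ioc_union_Ioi_eq_Ioi zero_le_one]
  refine IntegrableOn.union ?_ ?_
  · have hbound : IntegrableOn (fun r : ℝ => 2 * r) (Ioc 0 1) :=
      (by fun_prop : Continuous fun r : ℝ => 2 * r).integrableOn_Ioc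
    refine Integrable.mono' hbound hmeas.aestronglyMeasurable ?_
    refine ae_restrict_of_forall_mem measurableSet_Ioc fun r hr => ?_
    have h := hnonneg r hr.1
    have hr0 := hr.1
    rw [norm_of_nonneg (by positivity)]
    exact mul_le_of_le_one_right (by positivity) (one_sub_exp_neg_le_one _)
  · have hbound : IntegrableOn (fun r : ℝ => 2 * a * r ^ (1 - α)) (Ioi 1) :=
      (integrableOn_Ioi_rpow_of_lt (by linarith) one_pos).const_mul _
    refine Integrable.mono' hbound hmeas.aestronglyMeasurable ?_
    refine ae_restrict_of_forall_mem measurableSet_Ioi fun r hr => ?_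
    have hr0 : 0 < r := one_pos.trans hr
    have h := hnonneg r hr0
    rw [norm_of_nonneg (by positivity)]
    calc 2 * r * (1 - exp (-(a * r ^ (-α)))) ≤ 2 * r * (a * r ^ (-α)) := by
          gcongr; exact one_sub_exp_neg_le_self _
      _ = 2 * a * r ^ (1 - α) := by
          rw [sub_eq_add_neg, rpow_add hr0, rpow_one]; ring

lemma integrableOn_and_integral_mul_rpow_mul_exp_neg_mul_rpow {α : ℝ} (hα : 2 < α)
    {a : ℝ} (ha : 0 < a) :
    IntegrableOn (fun r : ℝ => a * α * r ^ (1 - α) * exp (-(a * r ^ (-α)))) (Ioi 0) ∧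
    ∫ r in Ioi (0 : ℝ), a * α * r ^ (1 - α) * exp (-(a * r ^ (-α)))
      = Gamma (1 - 2 / α) * a ^ (2 / α) := by
  have hα0 : 0 < α := by linarith
  have hlt : 2 / α < 1 := (div_lt_one hα0).2 hα
  let g : ℝ → ℝ := fun y => a * (y ^ ((1 - 2 / α) - 1) * exp (-(a * y)))
  have hsubst : EqOn (fun x : ℝ => (|-α| * x ^ (-α - 1)) • g (x ^ (-α)))
      (fun r : ℝ => a * α * r ^ (1 - α) * exp (-(a * r ^ (-α)))) (Ioi 0) := by
    intro r (hr : 0 < r)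
    have hpow : r ^ (-α - 1) * (r ^ (-α)) ^ ((1 - 2 / α) - 1) = r ^ (1 - α) := by
      rw [← rpow_mul hr.le, ← rpow_add hr]
      congr 1
      field_simp
      ring
    simp only [g, abs_neg, abs_of_pos hα0, smul_eq_mul, ← hpow]
    ring
  have hg : IntegrableOn g (Ioi 0) := by
    have h := integrableOn_rpow_mul_exp_neg_mul_rpow (p := 1) (s := (1 - 2 / α) - 1) (b := a)
      (by linarith) one_pos ha
    simp only [rpow_one, neg_mul] at h
    exact h.const_mul a
  refine ⟨((integrableOn_Ioi_comp_rpow_iff g (neg_ne_zero.2 hα0.ne')).2 hg).congr_fun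
    hsubst measurableSet_Ioi, ?_⟩
  rw [← setIntegral_congr_fun measurableSet_Ioi hsubst,
    integral_comp_rpow_Ioi g (neg_ne_zero.2 hα0.ne')]
  simp only [g]
  rw [integral_const_mul, integral_rpow_mul_exp_neg_mul_Ioi (by linarith) ha, one_div,
    inv_rpow ha.le, ← rpow_neg ha.le, ← mul_assoc, mul_comm (Gamma _), ← rpow_one_add' ha.le]
  · ring_nf
  · have : 0 < 2 / α := by positivity
    linarith

lemma hasDerivAt_sq_mul_one_sub_exp_neg_mul_rpow (α a : ℝ) {r : ℝ} (hr : 0 < r) :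
    HasDerivAt (fun r : ℝ => r ^ 2 * (1 - exp (-(a * r ^ (-α)))))
      (2 * r * (1 - exp (-(a * r ^ (-α)))) - a * α * r ^ (1 - α) * exp (-(a * r ^ (-α)))) r := by
  have hpow : r ^ (1 - α) = r ^ 2 * r ^ (-α - 1) := by
    rw [← rpow_natCast, ← rpow_add hr]
    congr 1
    push_cast
    ring
  have h := (((hasDerivAt_rpow_const (p := -α) (Or.inl hr.ne')).const_mul a).fun_neg.exp.const_sub
    1)
  refine ((hasDerivAt_pow 2 r).mul h).congr_deriv ?_
  rw [hpow]
  push_cast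
  ring

theorem integral_two_mul_one_sub_exp_neg_mul_rpow {α : ℝ} (hα : 2 < α) {a : ℝ} (ha : 0 ≤ a) :
    ∫ r in Ioi (0 : ℝ), 2 * r * (1 - exp (-(a * r ^ (-α))))
      = Gamma (1 - 2 / α) * a ^ (2 / α) := by
  rcases ha.eq_or_lt with rfl | ha
  · have : 2 / α ≠ 0 := by positivity
    simp [zero_rpow this]
  obtain ⟨hint, hval⟩ := integrableOn_and_integral_mul_rpow_mul_exp_neg_mul_rpow hα ha
  have hint' := integrableOn_two_mul_one_sub_exp_neg_mul_rpow hα ha.le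
  have hnonneg : ∀ r : ℝ, 0 ≤ r → 0 ≤ 1 - exp (-(a * r ^ (-α))) := fun r hr =>
    one_sub_exp_neg_nonneg (by positivity)
  have hzero : ContinuousWithinAt (fun r : ℝ => r ^ 2 * (1 - exp (-(a * r ^ (-α))))) (Ici 0) 0 := by
    have hsq : Tendsto (fun r : ℝ => r ^ 2) (𝓝[≥] 0) (𝓝 0) :=
      ((continuous_pow 2).tendsto' 0 0 (by simp)).mono_left nhdsWithin_le_nhds
    simp only [ContinuousWithinAt, ne_eq, OfNat.ofNat_ne_zero, not_false_eq_true, zero_pow,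
      zero_mul]
    refine squeeze_zero' ?_ ?_ hsq
    · filter_upwards [self_mem_nhdsWithin] with r hr
      exact mul_nonneg (sq_nonneg r) (hnonneg r hr)
    · exact Eventually.of_forall fun r =>
        mul_le_of_le_one_right (sq_nonneg r) (one_sub_exp_neg_le_one _)
  have htop : Tendsto (fun r : ℝ => r ^ 2 * (1 - exp (-(a * r ^ (-α))))) atTop (𝓝 0) := by
    have hpow : Tendsto (fun r : ℝ => a * r ^ (-(α - 2))) atTop (𝓝 0) := by
      simpa using (tendsto_rpow_neg_atTop (sub_pos.2 hα)).const_mul a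
    refine squeeze_zero' ?_ ?_ hpow
    · filter_upwards [eventually_ge_atTop 0] with r hr
      exact mul_nonneg (sq_nonneg r) (hnonneg r hr)
    · filter_upwards [eventually_gt_atTop 0] with r hr
      calc r ^ 2 * (1 - exp (-(a * r ^ (-α)))) ≤ r ^ 2 * (a * r ^ (-α)) := by
            gcongr; exact one_sub_exp_neg_le_self _
        _ = a * r ^ (-(α - 2)) := by
            rw [neg_sub, sub_eq_add_neg, rpow_add hr, rpow_two]; ring
  have hftc := integral_Ioi_of_hasDerivAt_of_tendsto hzero
    (fun r hr => hasDerivAt_sq_mul_one_sub_exp_neg_mul_rpow α a hr) (hint'.sub hint) htop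
  rw [integral_sub hint' hint, hval] at hftc
  simpa [sub_eq_zero] using hftc

theorem interference_exponent_general_fading
    {Ω : Type*} [MeasurableSpace Ω] (𝔓 : Measure Ω) [IsProbabilityMeasure 𝔓]
    (H : Ω → ℝ) (hH : ∀ ω, 0 ≤ H ω)
    (α : ℝ) (hα : 2 < α)
    (hmom : Integrable (fun ω => H ω ^ (2 / α)) 𝔓)
    (c : ℝ) (hc : 0 < c) :
    IntegrableOn
      (fun r : ℝ => 2 * r * (1 - ∫ ω, Real.exp (-(c * H ω * r ^ (-α))) ∂𝔓))
      (Set.Ioi (0:ℝ)) ∧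
    ∫ r in Set.Ioi (0:ℝ), 2 * r * (1 - ∫ ω, Real.exp (-(c * H ω * r ^ (-α))) ∂𝔓)
      = Real.Gamma (1 - 2 / α) * c ^ (2 / α) * ∫ ω, H ω ^ (2 / α) ∂𝔓 := by
  have hα0 : 0 < α := by linarith
  have hHmeas : AEMeasurable H 𝔓 := by
    refine (hmom.aemeasurable.pow_const (α / 2)).congr (Eventually.of_forall fun ω => ?_)
    simp only [← rpow_mul (hH ω)]
    rw [div_mul_div_cancel₀ hα0.ne', div_self two_ne_zero, rpow_one]
  have hcH : ∀ ω, 0 ≤ c * H ω := fun ω => mul_nonneg hc.le (hH ω)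
  let f : ℝ → Ω → ℝ := fun r ω => 2 * r * (1 - exp (-(c * H ω * r ^ (-α))))
  have hval : ∀ ω, ∫ r in Ioi (0 : ℝ), f r ω
      = Gamma (1 - 2 / α) * c ^ (2 / α) * H ω ^ (2 / α) := fun ω => by
    rw [integral_two_mul_one_sub_exp_neg_mul_rpow hα (hcH ω), mul_rpow hc.le (hH ω), mul_assoc]
  have hfmeas : AEStronglyMeasurable (Function.uncurry f)
      ((volume.restrict (Ioi (0 : ℝ))).prod 𝔓) := by
    have hH' : AEMeasurable (fun p : ℝ × Ω => H p.2) ((volume.restrict (Ioi (0 : ℝ))).prod 𝔓) :=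
      hHmeas.comp_snd
    refine AEMeasurable.aestronglyMeasurable ?_
    simp only [Function.uncurry_def, f]
    fun_prop
  have hfint : Integrable (Function.uncurry f) ((volume.restrict (Ioi (0 : ℝ))).prod 𝔓) := by
    refine (integrable_prod_iff' hfmeas).2 ⟨Eventually.of_forall fun ω =>
      integrableOn_two_mul_one_sub_exp_neg_mul_rpow hα (hcH ω), ?_⟩
    refine (hmom.const_mul (Gamma (1 - 2 / α) * c ^ (2 / α))).congr
      (Eventually.of_forall fun ω => ?_)
    simp only [← hval]
    refine setIntegral_congr_fun measurableSet_Ioi fun r (hr : 0 < r) => ?_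
    have h := one_sub_exp_neg_nonneg (mul_nonneg (hcH ω) (rpow_nonneg hr.le (-α)))
    exact (norm_of_nonneg (by simp only [f]; positivity)).symm
  have hinner : EqOn (fun r => ∫ ω, f r ω ∂𝔓)
      (fun r : ℝ => 2 * r * (1 - ∫ ω, exp (-(c * H ω * r ^ (-α))) ∂𝔓)) (Ioi 0) := by
    intro r (hr : 0 < r)
    have hexp : Integrable (fun ω => exp (-(c * H ω * r ^ (-α)))) 𝔓 := by
      refine Integrable.of_bound (AEMeasurable.aestronglyMeasurable (by fun_prop)) 1
        (Eventually.of_forall fun ω => ?_)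
      rw [norm_of_nonneg (exp_pos _).le, exp_le_one_iff, neg_nonpos]
      exact mul_nonneg (hcH ω) (rpow_nonneg hr.le _)
    simp only [f]
    rw [integral_const_mul, integral_sub (integrable_const 1) hexp]
    simp
  refine ⟨IntegrableOn.congr_fun hfint.integral_prod_left hinner measurableSet_Ioi, ?_⟩
  rw [← setIntegral_congr_fun measurableSet_Ioi hinner, integral_integral_swap hfint]
  simp only [hval, integral_const_mul]
end

section
/- Let m > 0, α > 2, and β > m be real numbers, and let Γ(s, x) = ∫_x^∞ t^{s−1} e^{−t} dt denote the upper incomplete Gamma function. Then ∫₀^∞ Γ(1 − 2/α, β·h) · h^{2/α} · (m^m · h^{m−1} · e^{−m·h} / Γ(m)) dh = (m^{m+1} / (β^{m + 2/α} · (m + 2/α))) · Σ_{n=0}^∞ [((m+1)_n · (m + 2/α)_n) / ((m + 2/α + 1)_n · n!)] · (−m/β)^n, where (x)_n = x(x+1)⋯(x+n−1) is the rising factorial (Pochhammer symbol) and the series converges absolutely since 0 < m/β < 1. -/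
open MeasureTheory Real Set

/-- The upper incomplete Gamma function `Γ(s, x) = ∫_x^∞ t^(s-1) e^(-t) dt`. -/
noncomputable def upperIncGamma (s x : ℝ) : ℝ :=
  ∫ t in Set.Ioi x, t ^ (s - 1) * Real.exp (-t)

/-- The rising factorial (Pochhammer symbol) `(x)_n = x (x+1) ⋯ (x+n-1)`. -/
noncomputable def risingFactorial (x : ℝ) (n : ℕ) : ℝ :=
  ∏ i ∈ Finset.range n, (x + i)

theorem risingFactorial_succ (x : ℝ) (n : ℕ) :
    risingFactorial x (n + 1) = risingFactorial x n * (x + n) :=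
  Finset.prod_range_succ _ _

theorem risingFactorial_pos {x : ℝ} (hx : 0 < x) (n : ℕ) : 0 < risingFactorial x n :=
  Finset.prod_pos fun _ _ => by positivity

theorem mul_risingFactorial_add_one (x : ℝ) (n : ℕ) :
    x * risingFactorial (x + 1) n = risingFactorial x n * (x + n) := by
  rw [← risingFactorial_succ, risingFactorial, risingFactorial, Finset.prod_range_succ', mul_comm]
  congr 1
  · exact Finset.prod_congr rfl fun i _ => by push_cast; ring
  · simp

theorem risingFactorial_div_risingFactorial_add_one {x : ℝ} (hx : 0 < x) (n : ℕ) :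
    risingFactorial x n / risingFactorial (x + 1) n = x / (x + n) := by
  have h : 0 < x + n := by positivity
  rw [div_eq_div_iff (risingFactorial_pos (by linarith) n).ne' h.ne',
    mul_risingFactorial_add_one]

theorem ring_choose_eq_risingFactorial_div (a : ℝ) (n : ℕ) :
    Ring.choose (a + n - 1) n = risingFactorial a n / n.factorial := by
  rw [eq_div_iff (by positivity), Ring.choose, show a + n - 1 - n + 1 = a by ring, mul_comm,
    ← nsmul_eq_mul, Ring.factorial_nsmul_multichoose_eq_ascPochhammer,
    Polynomial.ascPochhammer_smeval_eq_eval]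
  induction n with
  | zero => simp [risingFactorial]
  | succ n ih => rw [ascPochhammer_succ_eval, ih, risingFactorial_succ]

/-- The binomial series with negative exponent, in terms of rising factorials. -/
theorem hasSum_risingFactorial_mul_pow (a : ℝ) {x : ℝ} (hx : |x| < 1) :
    HasSum (fun n : ℕ => risingFactorial a n / n.factorial * x ^ n) ((1 - x) ^ (-a)) := by
  have h := (Real.one_div_one_sub_rpow_hasFPowerSeriesOnBall_zero a).hasSum (y := x)
    (by simpa [enorm_eq_nnnorm, ← NNReal.coe_lt_coe] using hx)
  have h1 : 0 ≤ 1 - x := by linarith [(abs_lt.mp hx).2]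
  simpa [FormalMultilinearSeries.ofScalars, ring_choose_eq_risingFactorial_div,
    Real.rpow_neg h1] using h

theorem hypergeometric_term_eq (a : ℝ) {b : ℝ} (hb : 0 < b) (x : ℝ) (n : ℕ) :
    risingFactorial a n * risingFactorial b n
        / (risingFactorial (b + 1) n * (n.factorial : ℝ)) * x ^ n
      = risingFactorial a n / n.factorial * x ^ n * (b / (b + n)) := by
  rw [← risingFactorial_div_risingFactorial_add_one hb]
  have := (risingFactorial_pos (by linarith : 0 < b + 1) n).ne'
  field_simp

theorem abs_hypergeometric_term {a b : ℝ} (ha : 0 < a) (hb : 0 < b) (x : ℝ) (n : ℕ) :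
    |risingFactorial a n * risingFactorial b n
        / (risingFactorial (b + 1) n * (n.factorial : ℝ)) * x ^ n|
      = risingFactorial a n / n.factorial * |x| ^ n * (b / (b + n)) := by
  have := risingFactorial_pos ha n
  rw [hypergeometric_term_eq a hb, abs_mul, abs_mul, abs_pow,
    abs_of_pos (by positivity : 0 < risingFactorial a n / n.factorial),
    abs_of_pos (by positivity : 0 < b / (b + n))]

theorem summable_abs_hypergeometric_term {a b x : ℝ} (ha : 0 < a) (hb : 0 < b) (hx : |x| < 1) :
    Summable fun n : ℕ => |risingFactorial a n * risingFactorial b n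
        / (risingFactorial (b + 1) n * (n.factorial : ℝ)) * x ^ n| := by
  refine (hasSum_risingFactorial_mul_pow a (x := |x|) (by rwa [abs_abs])).summable.of_nonneg_of_le
    (fun _ => abs_nonneg _) fun n => ?_
  rw [abs_hypergeometric_term ha hb]
  have := risingFactorial_pos ha n
  refine mul_le_of_le_one_right (by positivity) ((div_le_one (by positivity)).mpr ?_)
  simp

/-- An Euler-type integral representation of `₂F₁(a, b; b + 1; -c / β)`. -/
theorem integral_rpow_mul_add_rpow_neg {a b c β : ℝ} (ha : 0 < a) (hb : 0 < b) (hc : 0 < c)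
    (hβ : c < β) :
    ∫ u in Ioi β, u ^ (a - b - 1) * (u + c) ^ (-a)
      = (β ^ b * b)⁻¹ * ∑' n : ℕ, risingFactorial a n * risingFactorial b n
          / (risingFactorial (b + 1) n * (n.factorial : ℝ)) * (-c / β) ^ n := by
  have hβ0 : 0 < β := hc.trans hβ
  set F : ℕ → ℝ → ℝ := fun n u => risingFactorial a n / n.factorial * (-c) ^ n
    * u ^ (-b - n - 1) with hF
  have hlt (n : ℕ) : -b - n - 1 < -1 := by
    have : (0 : ℝ) ≤ n := by positivity
    linarith
  have hpow (n : ℕ) : ∫ u in Ioi β, u ^ (-b - n - 1) = (β ^ b * b)⁻¹ * (b / (b + n) / β ^ n) := by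
    rw [integral_Ioi_rpow_of_lt (hlt n) hβ0, show -b - n - 1 + 1 = -(b + n) by ring,
      Real.rpow_neg hβ0.le, Real.rpow_add hβ0, Real.rpow_natCast]
    have : 0 < b + n := by positivity
    have := Real.rpow_pos_of_pos hβ0 b
    field_simp
  have hint (n : ℕ) : Integrable (F n) (volume.restrict (Ioi β)) :=
    (integrableOn_Ioi_rpow_of_lt (hlt n) hβ0).const_mul _
  have hx : |-c / β| < 1 := by
    rw [abs_div, abs_neg, abs_of_pos hc, abs_of_pos hβ0]
    exact (div_lt_one hβ0).mpr hβ
  have hnorm (n : ℕ) : ∫ u in Ioi β, ‖F n u‖ = (β ^ b * b)⁻¹ *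
      |risingFactorial a n * risingFactorial b n
        / (risingFactorial (b + 1) n * (n.factorial : ℝ)) * (-c / β) ^ n| := by
    have h : ∀ u ∈ Ioi β, ‖F n u‖ = risingFactorial a n / n.factorial * c ^ n
        * u ^ (-b - n - 1) := by
      intro u hu
      have hu0 : 0 < u := hβ0.trans hu
      have := risingFactorial_pos ha n
      rw [hF, Real.norm_eq_abs, abs_mul, abs_mul, abs_pow, abs_neg, abs_of_pos hc,
        abs_of_pos (by positivity), abs_of_pos (Real.rpow_pos_of_pos hu0 _)]
    rw [setIntegral_congr_fun measurableSet_Ioi h, integral_const_mul, hpow,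
      abs_hypergeometric_term ha hb, abs_div, abs_neg, abs_of_pos hc, abs_of_pos hβ0, div_pow]
    ring
  have hsum : Summable fun n => ∫ u in Ioi β, ‖F n u‖ := by
    simp_rw [hnorm]
    exact (summable_abs_hypergeometric_term ha hb hx).mul_left _
  have hpt : ∀ u ∈ Ioi β, u ^ (a - b - 1) * (u + c) ^ (-a) = ∑' n, F n u := by
    intro u hu
    have hu0 : 0 < u := hβ0.trans hu
    have hxu : |-c / u| < 1 := by
      rw [abs_div, abs_neg, abs_of_pos hc, abs_of_pos hu0]
      exact (div_lt_one hu0).mpr (hβ.trans hu)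
    have h := (hasSum_risingFactorial_mul_pow a hxu).mul_left (u ^ (-b - 1))
    rw [show u + c = u * (1 - -c / u) by field_simp; ring,
      Real.mul_rpow hu0.le (by linarith [(abs_lt.mp hxu).2]), ← mul_assoc, ← Real.rpow_add hu0,
      show a - b - 1 + -a = -b - 1 by ring, ← h.tsum_eq]
    refine tsum_congr fun n => ?_
    simp only [hF]
    rw [show -b - (n : ℝ) - 1 = -b - 1 - n by ring, Real.rpow_sub_natCast hu0.ne', div_pow]
    ring
  rw [setIntegral_congr_fun measurableSet_Ioi hpt,
    ← integral_tsum_of_summable_integral_norm hint hsum, ← tsum_mul_left]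
  refine tsum_congr fun n => ?_
  rw [hF, integral_const_mul, hpow, hypergeometric_term_eq a hb, div_pow]
  ring

theorem upperIncGamma_mul {h : ℝ} (hh : 0 < h) (s β : ℝ) (hβ : 0 < β) :
    upperIncGamma s (β * h) = h ^ s * ∫ u in Ioi β, u ^ (s - 1) * Real.exp (-(h * u)) := by
  rw [upperIncGamma, mul_comm β h, ← integral_comp_mul_left_Ioi' _ β hh, smul_eq_mul,
    ← integral_const_mul, ← integral_const_mul]
  refine setIntegral_congr_fun measurableSet_Ioi fun u hu => ?_
  have hu0 : 0 < u := hβ.trans hu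
  rw [Real.mul_rpow hh.le hu0.le, Real.rpow_sub_one hh.ne']
  field_simp

theorem integral_rpow_mul_exp_neg_mul {q b : ℝ} (hq : -1 < q) (hb : 0 < b) :
    ∫ x in Ioi (0 : ℝ), x ^ q * Real.exp (-(b * x)) = b ^ (-(q + 1)) * Real.Gamma (q + 1) := by
  simpa using integral_rpow_mul_exp_neg_mul_rpow (p := 1) one_pos hq hb

theorem integrableOn_rpow_mul_exp_neg_mul {q b : ℝ} (hq : -1 < q) (hb : 0 < b) :
    IntegrableOn (fun x : ℝ => x ^ q * Real.exp (-(b * x))) (Ioi 0) := by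
  simpa using integrableOn_rpow_mul_exp_neg_mul_rpow (p := 1) hq one_pos hb

/-- The Laplace transform of an upper incomplete Gamma function times a power, as an integral
over the half-line `(β, ∞)`. -/
theorem integral_upperIncGamma_mul_rpow_mul_exp {s b c β : ℝ} (hb : 0 < b) (hs : -b < s)
    (hc : 0 < c) (hβ : 0 < β) :
    ∫ h in Ioi (0 : ℝ), upperIncGamma s (β * h) * (h ^ (b - 1) * Real.exp (-(c * h)))
      = Real.Gamma (s + b) * ∫ u in Ioi β, u ^ (s - 1) * (u + c) ^ (-(s + b)) := by
  set f : ℝ → ℝ → ℝ := fun h u =>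
    u ^ (s - 1) * (h ^ (s + b - 1) * Real.exp (-((u + c) * h))) with hf
  have hq : -1 < s + b - 1 := by linarith
  have hinner : ∀ u ∈ Ioi β, ∫ h in Ioi (0 : ℝ), f h u
      = Real.Gamma (s + b) * (u ^ (s - 1) * (u + c) ^ (-(s + b))) := by
    intro u hu
    have hu0 : 0 < u := hβ.trans hu
    rw [hf, integral_const_mul, integral_rpow_mul_exp_neg_mul hq (by linarith), sub_add_cancel]
    ring
  have hmeas : Measurable (Function.uncurry f) := by
    rw [hf]
    unfold Function.uncurry
    fun_prop
  have hnorm : ∀ u ∈ Ioi β, ∫ h in Ioi (0 : ℝ), ‖f h u‖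
      = Real.Gamma (s + b) * (u ^ (s - 1) * (u + c) ^ (-(s + b))) := by
    intro u hu
    have hu0 : 0 < u := hβ.trans hu
    rw [← hinner u hu]
    refine setIntegral_congr_fun measurableSet_Ioi fun h hh => ?_
    have hh0 : 0 < h := hh
    exact Real.norm_of_nonneg (by positivity)
  have hint : Integrable (Function.uncurry f)
      ((volume.restrict (Ioi 0)).prod (volume.restrict (Ioi β))) := by
    rw [integrable_prod_iff' hmeas.aestronglyMeasurable]
    refine ⟨ae_restrict_of_forall_mem measurableSet_Ioi fun u hu => ?_, ?_⟩
    · have hu0 : 0 < u := hβ.trans hu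
      exact (integrableOn_rpow_mul_exp_neg_mul hq (by linarith : 0 < u + c)).const_mul (u ^ (s - 1))
    · refine IntegrableOn.congr_fun ?_ (fun u hu => (hnorm u hu).symm) measurableSet_Ioi
      refine Integrable.const_mul ?_ _
      refine Integrable.mono'
        (integrableOn_Ioi_rpow_of_lt (by linarith : -b - 1 < -1) hβ)
        (by fun_prop) (ae_restrict_of_forall_mem measurableSet_Ioi fun u hu => ?_)
      have hu0 : 0 < u := hβ.trans hu
      rw [Real.norm_of_nonneg (by positivity), show -b - 1 = s - 1 + -(s + b) by ring,
        Real.rpow_add hu0]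
      exact mul_le_mul_of_nonneg_left
        (Real.rpow_le_rpow_of_nonpos hu0 (by linarith) (by linarith)) (by positivity)
  rw [← integral_const_mul, ← setIntegral_congr_fun measurableSet_Ioi hinner,
    ← integral_integral_swap hint]
  refine setIntegral_congr_fun measurableSet_Ioi fun h hh => ?_
  have hh0 : 0 < h := hh
  simp only [hf]
  rw [upperIncGamma_mul hh0 s β hβ, mul_right_comm, ← integral_const_mul]
  refine setIntegral_congr_fun measurableSet_Ioi fun u _ => ?_
  rw [show -((u + c) * h) = -(h * u) + -(c * h) by ring, Real.exp_add,
    show s + b - 1 = s + (b - 1) by ring, Real.rpow_add hh0]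
  ring

theorem incGamma_nakagami_expectation
    (m α β : ℝ) (hm : 0 < m) (hα : 2 < α) (hβ : m < β) :
    Summable (fun n : ℕ =>
      |risingFactorial (m + 1) n * risingFactorial (m + 2 / α) n
          / (risingFactorial (m + 2 / α + 1) n * (n.factorial : ℝ))
        * (-m / β) ^ n|) ∧
    ∫ h in Set.Ioi (0:ℝ),
        upperIncGamma (1 - 2 / α) (β * h) * h ^ (2 / α)
          * (m ^ m * h ^ (m - 1) * Real.exp (-(m * h)) / Real.Gamma m)
      = (m ^ (m + 1) / (β ^ (m + 2 / α) * (m + 2 / α)))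
          * ∑' n : ℕ,
              risingFactorial (m + 1) n * risingFactorial (m + 2 / α) n
                / (risingFactorial (m + 2 / α + 1) n * (n.factorial : ℝ))
                * (-m / β) ^ n := by
  have hβ0 : 0 < β := hm.trans hβ
  have hd : 0 < 2 / α := by positivity
  have hx : |-m / β| < 1 := by
    rw [abs_div, abs_neg, abs_of_pos hm, abs_of_pos hβ0]
    exact (div_lt_one hβ0).mpr hβ
  refine ⟨summable_abs_hypergeometric_term (by linarith) (by linarith) hx, ?_⟩
  generalize 2 / α = d at hd ⊢
  have hcongr : ∀ h ∈ Ioi (0 : ℝ), upperIncGamma (1 - d) (β * h) * h ^ d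
      * (m ^ m * h ^ (m - 1) * Real.exp (-(m * h)) / Real.Gamma m)
      = m ^ m / Real.Gamma m * (upperIncGamma (1 - d) (β * h)
        * (h ^ (m + d - 1) * Real.exp (-(m * h)))) := by
    intro h hh
    rw [show m + d - 1 = d + (m - 1) by ring, Real.rpow_add hh]
    ring
  have hΓ := (Real.Gamma_pos_of_pos hm).ne'
  rw [setIntegral_congr_fun measurableSet_Ioi hcongr, integral_const_mul,
    integral_upperIncGamma_mul_rpow_mul_exp (by linarith) (by linarith) hm hβ0,
    show 1 - d + (m + d) = m + 1 by ring, show 1 - d - 1 = m + 1 - (m + d) - 1 by ring,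
    integral_rpow_mul_add_rpow_neg (by linarith) (by linarith) hm hβ, Real.Gamma_add_one hm.ne',
    Real.rpow_add_one hm.ne']
  field_simp
end

section
/- For every real φ > 0, ∫₀^∞ 4 / ((1 + φ·s²) · (2s − 2·arctan(s) + π)) ds ≤ ∫₀^∞ 2(1 + s) / ((1 + φ·s²) · (1 + s + s²)) ds. -/
open MeasureTheory Real Set

theorem div_one_add_le_arctan {y : ℝ} (hy : 0 ≤ y) : y / (1 + y) ≤ arctan y :=
  calc y / (1 + y) ≤ y / √(1 + y ^ 2) := by
        gcongr
        exact Real.sqrt_le_iff.mpr ⟨by positivity, by nlinarith⟩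
    _ = sin (arctan y) := (sin_arctan y).symm
    _ ≤ arctan y := sin_le (arctan_nonneg.mpr hy)

theorem inv_one_add_le_pi_div_two_sub_arctan {s : ℝ} (hs : 0 < s) :
    1 / (1 + s) ≤ π / 2 - arctan s := by
  rw [← arctan_inv_of_pos hs]
  convert div_one_add_le_arctan (inv_nonneg.mpr hs.le) using 1
  field_simp
  ring

theorem two_mul_quadratic_le {s : ℝ} (hs : 0 < s) :
    2 * (1 + s + s ^ 2) ≤ (1 + s) * (2 * s - 2 * arctan s + π) := by
  have h := inv_one_add_le_pi_div_two_sub_arctan hs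
  rw [div_le_iff₀ (by positivity)] at h
  linarith

theorem integrable_inv_one_add_mul_sq {φ : ℝ} (hφ : 0 < φ) :
    Integrable fun s : ℝ ↦ (1 + φ * s ^ 2)⁻¹ := by
  have h := integrable_inv_one_add_sq.comp_mul_left' (Real.sqrt_pos.mpr hφ).ne'
  simpa only [mul_pow, Real.sq_sqrt hφ.le] using h

theorem integrableOn_rate_majorant {φ : ℝ} (hφ : 0 < φ) :
    IntegrableOn (fun s : ℝ ↦ 2 * (1 + s) / ((1 + φ * s ^ 2) * (1 + s + s ^ 2))) (Ioi 0) := by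
  refine ((integrable_inv_one_add_mul_sq hφ).integrableOn.const_mul 2).mono'
    (Measurable.aestronglyMeasurable (by fun_prop)) ?_
  refine (ae_restrict_iff' measurableSet_Ioi).mpr (.of_forall fun s (hs : 0 < s) ↦ ?_)
  rw [norm_of_nonneg (by positivity), ← div_eq_mul_inv,
    div_le_div_iff₀ (by positivity) (by positivity)]
  have : 0 ≤ (1 + φ * s ^ 2) * s ^ 2 := by positivity
  linarith

theorem rate_integral_upper_bound (φ : ℝ) (hφ : 0 < φ) :
    ∫ s in Set.Ioi (0:ℝ), 4 / ((1 + φ * s ^ 2) * (2 * s - 2 * Real.arctan s + π))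
      ≤ ∫ s in Set.Ioi (0:ℝ),
          2 * (1 + s) / ((1 + φ * s ^ 2) * (1 + s + s ^ 2)) := by
  have denom_pos {s : ℝ} (hs : 0 < s) : 0 < 2 * s - 2 * arctan s + π := by
    linarith [arctan_lt_pi_div_two s]
  refine integral_mono_of_nonneg ?_ (integrableOn_rate_majorant hφ) ?_
  · refine (ae_restrict_iff' measurableSet_Ioi).mpr (.of_forall fun s (hs : 0 < s) ↦ ?_)
    have := denom_pos hs
    simp only [Pi.zero_apply]
    positivity
  · refine (ae_restrict_iff' measurableSet_Ioi).mpr (.of_forall fun s (hs : 0 < s) ↦ ?_)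
    have hD := denom_pos hs
    have hA : 0 < 1 + φ * s ^ 2 := by positivity
    have h := mul_le_mul_of_nonneg_left (two_mul_quadratic_le hs) hA.le
    simp only
    rw [div_le_div_iff₀ (by positivity) (by positivity)]
    linarith
end

section
/- For every real φ with 0 < φ ≤ 1, ∫₀^∞ 2(1 + s) / ((1 + φ·s²) · (1 + s + s²)) ds = (π·φ^{3/2} + (2π/(3√3))·(1 − 2φ) − ln(φ)) / (φ² − φ + 1). -/
open MeasureTheory Real Set

open Filter Topology in
theorem tendsto_log_one_add_add_sq_sub_log_one_add_mul_sq {φ : ℝ} (hφ : 0 < φ) :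
    Tendsto (fun s : ℝ => log (1 + s + s ^ 2) - log (1 + φ * s ^ 2)) atTop (𝓝 (-log φ)) := by
  have hi : Tendsto (fun s : ℝ => s⁻¹) atTop (𝓝 0) := tendsto_inv_atTop_zero
  have hratio : Tendsto (fun s : ℝ => (s⁻¹ ^ 2 + s⁻¹ + 1) / (s⁻¹ ^ 2 + φ)) atTop (𝓝 φ⁻¹) := by
    have h := (((hi.pow 2).add hi).add_const 1).div ((hi.pow 2).add_const φ)
      (by simpa using hφ.ne')
    simpa [Pi.div_def] using h
  have hlog := hratio.log (inv_ne_zero hφ.ne')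
  rw [log_inv] at hlog
  refine hlog.congr' ?_
  filter_upwards [eventually_gt_atTop 0] with s hs
  rw [← log_div (by positivity) (by positivity)]
  congr 1
  field_simp

/-- An antiderivative of `2 (1 + s) / ((1 + r² s²) (1 + s + s²))`. -/
noncomputable def ratePrimitive (r s : ℝ) : ℝ :=
  (log (1 + s + s ^ 2) - log (1 + r ^ 2 * s ^ 2)
    + (1 - 2 * r ^ 2) * (2 / √3) * arctan ((2 * s + 1) / √3)
    + 2 * r ^ 3 * arctan (r * s)) / ((r ^ 2) ^ 2 - r ^ 2 + 1)

theorem hasDerivAt_ratePrimitive (r : ℝ) (s : ℝ) :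
    HasDerivAt (ratePrimitive r)
      (2 * (1 + s) / ((1 + r ^ 2 * s ^ 2) * (1 + s + s ^ 2))) s := by
  have hq : 1 + s + s ^ 2 ≠ 0 := by nlinarith [sq_nonneg (2 * s + 1)]
  have hp : 1 + r ^ 2 * s ^ 2 ≠ 0 := by positivity
  have hD : (r ^ 2) ^ 2 - r ^ 2 + 1 ≠ 0 := by nlinarith [sq_nonneg (2 * r ^ 2 - 1)]
  have hid := hasDerivAt_id' s
  have h1 := ((hid.const_add 1).add (hid.pow 2)).log hq
  have h2 := (((hid.pow 2).const_mul (r ^ 2)).const_add 1).log hp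
  have h3 := (((hid.const_mul 2).add_const 1).div_const √3).arctan
  have h4 := (hid.const_mul r).arctan
  have h := (((h1.sub h2).add (h3.const_mul ((1 - 2 * r ^ 2) * (2 / √3)))).add
    (h4.const_mul (2 * r ^ 3))).div_const ((r ^ 2) ^ 2 - r ^ 2 + 1)
  refine h.congr_deriv ?_
  have h3sq : √3 ^ 2 = (3 : ℝ) := sq_sqrt (by norm_num)
  have hatan : (1 - 2 * r ^ 2) * (2 / √3) *
      (1 / (1 + ((2 * s + 1) / √3) ^ 2) * (2 * 1 / √3)) =
      (1 - 2 * r ^ 2) / (1 + s + s ^ 2) := by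
    rw [div_pow, h3sq]
    have hq' : 1 + (2 * s + 1) ^ 2 / 3 = 4 / 3 * (1 + s + s ^ 2) := by ring
    rw [hq']
    field_simp
    rw [h3sq]
    ring
  rw [hatan, mul_pow]
  simp only [Pi.add_apply, Pi.pow_apply, Nat.cast_ofNat, Nat.add_one_sub_one, pow_one, mul_one]
  rw [div_eq_iff hD]
  field_simp
  ring

open Filter Topology in
theorem tendsto_ratePrimitive_atTop {r : ℝ} (hr : 0 < r) :
    Tendsto (ratePrimitive r) atTop
      (𝓝 ((-log (r ^ 2) + (1 - 2 * r ^ 2) * (2 / √3) * (π / 2) + 2 * r ^ 3 * (π / 2)) /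
        ((r ^ 2) ^ 2 - r ^ 2 + 1))) := by
  have harctan : Tendsto arctan atTop (𝓝 (π / 2)) :=
    tendsto_nhds_of_tendsto_nhdsWithin tendsto_arctan_atTop
  have h1 : Tendsto (fun s : ℝ => (2 * s + 1) / √3) atTop atTop :=
    (tendsto_atTop_add_const_right _ _ (tendsto_id.const_mul_atTop two_pos)).atTop_div_const
      (by positivity)
  have h2 : Tendsto (fun s : ℝ => r * s) atTop atTop := tendsto_id.const_mul_atTop hr
  exact (((tendsto_log_one_add_add_sq_sub_log_one_add_mul_sq (pow_pos hr 2)).add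
    ((harctan.comp h1).const_mul _)).add ((harctan.comp h2).const_mul _)).div_const _

theorem ratePrimitive_zero (r : ℝ) :
    ratePrimitive r 0 =
      (1 - 2 * r ^ 2) * (2 / √3) * (π / 6) / ((r ^ 2) ^ 2 - r ^ 2 + 1) := by
  simp [ratePrimitive, arctan_inv_sqrt_three]

theorem rate_upper_bound_closed_form (φ : ℝ) (hφ0 : 0 < φ) (hφ1 : φ ≤ 1) :
    ∫ s in Set.Ioi (0:ℝ), 2 * (1 + s) / ((1 + φ * s ^ 2) * (1 + s + s ^ 2))
      = (π * φ ^ ((3:ℝ) / 2) + (2 * π / (3 * Real.sqrt 3)) * (1 - 2 * φ)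
          - Real.log φ) / (φ ^ 2 - φ + 1) := by
  obtain ⟨r, hr, rfl⟩ : ∃ r : ℝ, 0 < r ∧ φ = r ^ 2 :=
    ⟨√φ, sqrt_pos.2 hφ0, (sq_sqrt hφ0.le).symm⟩
  have hpow : (r ^ 2) ^ ((3 : ℝ) / 2) = r ^ 3 := by
    rw [← rpow_natCast r 2, ← rpow_mul hr.le, ← rpow_natCast r 3]
    norm_num
  rw [integral_Ioi_of_hasDerivAt_of_nonneg' (fun s _ => hasDerivAt_ratePrimitive r s)
    (fun s hs => by have : 0 < s := hs; positivity) (tendsto_ratePrimitive_atTop hr),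
    ratePrimitive_zero, hpow, ← sub_div]
  congr 1
  ring
end
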